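/- arXiv:2501.01065 — 7 statements merged into one kernel-verified Lean document; each statement's English description precedes it below -/
import Mathlib

section
/- Let m ≥ 1 and let p_1,…,p_m be random variables on a common probability space, each uniformly distributed on the interval [0,1], and let w_1,…,w_m > 0 with ∑_{j=1}^m w_j = 1. Suppose there exists a function t ↦ δ_t from (0,∞) to (0,∞) with δ_t → 0 and t·δ_t → ∞ as t → ∞ such that for all i ≠ j, t · P( p_i < 2 w_i m/(π t) and p_j < 2 w_j m/(π δ_t t) ) → 0 as t → ∞. Then lim_{t→∞} t · P(∑_{j=1}^m w_j / p_j > t) = 1. -/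
open MeasureTheory Real Filter

lemma unif_real {Ω : Type*} [MeasurableSpace Ω] (P : Measure Ω)
    (q : Ω → ℝ) (hq : Measurable q)
    (hu : Measure.map q P = volume.restrict (Set.Icc (0:ℝ) 1)) (x : ℝ) :
    P {ω | q ω < x} = volume (Set.Iio x ∩ Set.Icc (0:ℝ) 1) := by
  have h : P {ω | q ω < x} = Measure.map q P (Set.Iio x) := by
    rw [Measure.map_apply hq measurableSet_Iio]; rfl
  rw [h, hu, Measure.restrict_apply measurableSet_Iio]

lemma unif_le {Ω : Type*} [MeasurableSpace Ω] (P : Measure Ω)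
    (q : Ω → ℝ) (hq : Measurable q)
    (hu : Measure.map q P = volume.restrict (Set.Icc (0:ℝ) 1)) (x : ℝ) (hx : 0 ≤ x) :
    P.real {ω | q ω < x} ≤ x := by
  rw [Measure.real, unif_real P q hq hu]
  apply ENNReal.toReal_le_of_le_ofReal hx
  calc _ ≤ volume (Set.Icc 0 x) := measure_mono (fun y hy => ⟨hy.2.1, le_of_lt hy.1⟩)
    _ = _ := by rw [Real.volume_Icc, sub_zero]

lemma unif_ge {Ω : Type*} [MeasurableSpace Ω] (P : Measure Ω) [IsProbabilityMeasure P]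
    (q : Ω → ℝ) (hq : Measurable q)
    (hu : Measure.map q P = volume.restrict (Set.Icc (0:ℝ) 1)) (x : ℝ) (hx1 : x ≤ 1) :
    x ≤ P.real {ω | q ω < x} := by
  rw [Measure.real, ← ENNReal.ofReal_le_iff_le_toReal (measure_ne_top _ _), unif_real P q hq hu]
  calc _ = volume (Set.Ico 0 x) := by rw [Real.volume_Ico, sub_zero]
    _ ≤ volume (Set.Iio x ∩ Set.Icc (0:ℝ) 1) :=
      measure_mono (fun y hy => ⟨hy.2, hy.1, hy.2.le.trans hx1⟩)

lemma unif_pos {Ω : Type*} [MeasurableSpace Ω] (P : Measure Ω)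
    (q : Ω → ℝ) (hq : Measurable q)
    (hu : Measure.map q P = volume.restrict (Set.Icc (0:ℝ) 1)) :
    ∀ᵐ ω ∂P, 0 < q ω := by
  have h : ∀ᵐ y ∂(Measure.map q P), 0 < y := by
    rw [hu, ae_iff, Measure.restrict_apply (by measurability)]
    refine measure_mono_null (t := {(0:ℝ)}) ?_ (by simp)
    rintro y ⟨h1, h2, h3⟩
    simp only [Set.mem_ofPred_eq, not_lt] at h1
    exact le_antisymm h1 h2
  exact ae_of_ae_map hq.aemeasurable h

/-- Deterministic step of the upper bound. -/
lemma det_upper (m : ℕ) (hm : 1 ≤ m) (X : Fin m → ℝ) (t η : ℝ) (ht : 0 < t) (hη : 0 < η)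
    (hS : t < ∑ j, X j) (hB : ∀ i j, i ≠ j → ¬ (t / m < X i ∧ η * t / m < X j)) :
    ∃ i, (1 - η) * t < X i := by
  have hm0 : (0:ℝ) < m := by exact_mod_cast hm
  obtain ⟨i, hi⟩ : ∃ i, t / m < X i := by
    by_contra! h
    have : ∑ j, X j ≤ ∑ _j : Fin m, t / m := Finset.sum_le_sum fun j _ => h j
    rw [Finset.sum_const, Finset.card_univ, Fintype.card_fin, nsmul_eq_mul,
      mul_div_cancel₀ _ hm0.ne'] at this
    linarith
  refine ⟨i, ?_⟩
  have h2 : ∑ j ∈ Finset.univ.erase i, X j ≤ ∑ _j ∈ Finset.univ.erase i, η * t / m := by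
    refine Finset.sum_le_sum fun j hj => ?_
    by_contra! h
    exact hB i j (Finset.ne_of_mem_erase hj).symm ⟨hi, h⟩
  have h3 : ∑ _j ∈ Finset.univ.erase i, η * t / m ≤ ∑ _j : Fin m, η * t / m :=
    Finset.sum_le_sum_of_subset_of_nonneg (Finset.erase_subset _ _) (fun _ _ _ => by positivity)
  have h5 : ∑ _j : Fin m, η * t / m = η * t := by
    rw [Finset.sum_const, Finset.card_univ, Fintype.card_fin, nsmul_eq_mul,
      mul_div_cancel₀ _ hm0.ne']
  have h4 := Finset.add_sum_erase Finset.univ X (Finset.mem_univ i)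
  linarith

/-- Theorem 5.4 (fixed-m EHMP case): under weak pairwise tail dependence, the tail probability of
the harmonic-mean combination statistic is asymptotically the Pareto(1,1) tail `1/t`. -/
theorem ehmp_tail_validity
    (m : ℕ) (hm : 1 ≤ m)
    (Ω : Type*) [MeasurableSpace Ω] (P : Measure Ω) [IsProbabilityMeasure P]
    (p : Fin m → Ω → ℝ) (hmeas : ∀ j, Measurable (p j))
    (hunif : ∀ j, Measure.map (p j) P = volume.restrict (Set.Icc (0:ℝ) 1))
    (w : Fin m → ℝ) (hw : ∀ j, 0 < w j) (hwsum : ∑ j, w j = 1)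
    (δ : ℝ → ℝ) (hδpos : ∀ t > (0:ℝ), 0 < δ t)
    (hδ0 : Tendsto δ atTop (nhds 0))
    (hδt : Tendsto (fun t => t * δ t) atTop atTop)
    (hpair : ∀ i j, i ≠ j →
      Tendsto (fun t => t *
          (P {ω | p i ω < 2 * w i * m / (π * t) ∧
              p j ω < 2 * w j * m / (π * δ t * t)}).toReal)
        atTop (nhds 0)) :
    Tendsto (fun t => t * (P {ω | t < ∑ j, w j / p j ω}).toReal)
      atTop (nhds 1) := by
  have hm0 : (0:ℝ) < m := by exact_mod_cast hm
  have hm1 : (1:ℝ) ≤ m := by exact_mod_cast hm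
  have hs : Tendsto (fun t : ℝ => 2 / π * t) atTop atTop :=
    tendsto_id.const_mul_atTop (by positivity)
  set η : ℝ → ℝ := fun t => δ (2 / π * t) with hη
  have hη0 : Tendsto η atTop (nhds 0) := hδ0.comp hs
  have hηpos : ∀ t > 0, 0 < η t := fun t ht => hδpos _ (by positivity)
  let C : ℝ → Fin m → Fin m → Set Ω := fun t i j =>
    {ω | p i ω < w i * m / t ∧ p j ω < w j * m / (η t * t)}
  let B : ℝ → Set Ω := fun t => ⋃ i, ⋃ j, {ω | i ≠ j ∧ ω ∈ C t i j}
  have hCmeas : ∀ t i j, MeasurableSet (C t i j) := fun t i j =>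
    (measurableSet_lt (hmeas i) measurable_const).inter
      (measurableSet_lt (hmeas j) measurable_const)
  have hBmeas : ∀ t, MeasurableSet (B t) := fun t =>
    MeasurableSet.iUnion fun i => MeasurableSet.iUnion fun j =>
      (MeasurableSet.const _).inter (hCmeas t i j)
  have hClim : ∀ i j, i ≠ j → Tendsto (fun t => t * P.real (C t i j)) atTop (nhds 0) := by
    intro i j hij
    have h := ((hpair i j hij).comp hs).const_mul (π / 2)
    rw [mul_zero] at h
    refine h.congr' ?_
    filter_upwards [eventually_gt_atTop 0] with t ht
    have h1 : 2 * w i * m / (π * (2 / π * t)) = w i * m / t := by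
      field_simp
    have hp := hηpos t ht
    have h2 : 2 * w j * m / (π * η t * (2 / π * t)) = w j * m / (η t * t) := by
      field_simp
    simp only [Function.comp]
    change π / 2 * (2 / π * t * P.real {ω | p i ω < 2 * w i * m / (π * (2 / π * t)) ∧
      p j ω < 2 * w j * m / (π * η t * (2 / π * t))}) = t * P.real (C t i j)
    rw [h1, h2]
    have : π ≠ 0 := pi_ne_zero
    change _ = t * P.real (C t i j)
    change π / 2 * (2 / π * t * P.real (C t i j)) = _
    generalize P.real (C t i j) = z
    field_simp
  have hDlim : ∀ i j, Tendsto (fun t => t * P.real {ω | i ≠ j ∧ ω ∈ C t i j}) atTop (nhds 0) := by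
    intro i j
    by_cases hij : i = j
    · simp [hij]
    · simpa [hij] using hClim i j hij
  have hBlim : Tendsto (fun t => t * P.real (B t)) atTop (nhds 0) := by
    have h : Tendsto (fun t => ∑ i, ∑ j, t * P.real {ω | i ≠ j ∧ ω ∈ C t i j}) atTop
        (nhds (∑ _i : Fin m, ∑ _j : Fin m, (0:ℝ))) :=
      tendsto_finsetSum _ fun i _ => tendsto_finsetSum _ fun j _ => hDlim i j
    simp only [Finset.sum_const_zero] at h
    refine tendsto_of_tendsto_of_tendsto_of_le_of_le' tendsto_const_nhds h ?_ ?_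
    · filter_upwards [eventually_gt_atTop 0] with t ht
      positivity
    · filter_upwards [eventually_gt_atTop 0] with t ht
      simp only [← Finset.mul_sum]
      refine mul_le_mul_of_nonneg_left ?_ ht.le
      refine (measureReal_iUnion_fintype_le _).trans ?_
      exact Finset.sum_le_sum fun i _ => measureReal_iUnion_fintype_le _
  have hpos : ∀ᵐ ω ∂P, ∀ j, 0 < p j ω :=
    ae_all_iff.2 fun j => unif_pos P (p j) (hmeas j) (hunif j)
  have hev : ∀ᶠ t in atTop, 1 ≤ t ∧ 0 < η t ∧ η t < 1 := by
    filter_upwards [eventually_ge_atTop 1, hη0.eventually (gt_mem_nhds one_pos)] with t ht h1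
    exact ⟨ht, hηpos t (by linarith), h1⟩
  have hlow : Tendsto (fun t => 1 - m * (t * P.real (B t))) atTop (nhds 1) := by
    simpa using (hBlim.const_mul (m:ℝ)).const_sub 1
  have hup : Tendsto (fun t => (1 - η t)⁻¹ + t * P.real (B t)) atTop (nhds 1) := by
    have h1 : Tendsto (fun t => (1 - η t)⁻¹) atTop (nhds 1) := by
      simpa using (hη0.const_sub 1).inv₀ (by norm_num)
    simpa using h1.add hBlim
  refine tendsto_of_tendsto_of_tendsto_of_le_of_le' hlow hup ?_ ?_
  · filter_upwards [hev] with t ⟨ht1, he0, he1⟩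
    have ht : 0 < t := by linarith
    change _ ≤ t * P.real {ω | t < ∑ j, w j / p j ω}
    let A : Fin m → Set Ω := fun i => {ω | p i ω < w i / t}
    have hAmeas : ∀ i, MeasurableSet (A i) := fun i =>
      measurableSet_lt (hmeas i) measurable_const
    have hw1 : ∀ i, w i ≤ 1 := fun i => by
      rw [← hwsum]
      exact Finset.single_le_sum (fun j _ => (hw j).le) (Finset.mem_univ i)
    have hA : ∀ i, w i / t ≤ P.real (A i) := fun i =>
      unif_ge P (p i) (hmeas i) (hunif i) _ (by rw [div_le_one ht]; linarith [hw1 i])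
    have hdisj : Pairwise (Function.onFun Disjoint fun i => A i \ B t) := by
      intro i j hij
      refine Set.disjoint_left.2 ?_
      rintro ω ⟨hi, hiB⟩ ⟨hj, _⟩
      apply hiB
      refine Set.mem_iUnion.2 ⟨i, Set.mem_iUnion.2 ⟨j, hij, ?_, ?_⟩⟩
      · refine lt_of_lt_of_le hi ?_
        gcongr
        have := hw i
        nlinarith
      · refine lt_of_lt_of_le hj ?_
        have := hw j
        have h1 : η t * t ≤ t := by nlinarith
        have h2 : 0 < η t * t := by positivity
        gcongr
        nlinarith
    have hsum : P.real (⋃ i, A i \ B t) = ∑ i, P.real (A i \ B t) :=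
      measureReal_iUnion_fintype hdisj (fun i => (hAmeas i).diff (hBmeas t))
    have hle : P.real (⋃ i, A i \ B t) ≤ P.real {ω | t < ∑ j, w j / p j ω} := by
      refine ENNReal.toReal_mono (measure_ne_top _ _) (measure_mono_ae ?_)
      filter_upwards [hpos] with ω hω hmem
      obtain ⟨i, hi, _⟩ := Set.mem_iUnion.1 hmem
      change t < ∑ j, w j / p j ω
      have h1 : t < w i / p i ω := by
        rw [lt_div_iff₀ (hω i), mul_comm]
        exact (lt_div_iff₀ ht).1 hi
      refine h1.trans_le ?_
      exact Finset.single_le_sum (f := fun j => w j / p j ω)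
        (fun j _ => (div_pos (hw j) (hω j)).le) (Finset.mem_univ i)
    have hge : ∑ i, (w i / t - P.real (B t)) ≤ ∑ i, P.real (A i \ B t) := by
      refine Finset.sum_le_sum fun i _ => ?_
      have := le_measureReal_sdiff (μ := P) (s₁ := A i) (s₂ := B t)
      linarith [hA i]
    rw [Finset.sum_sub_distrib, ← Finset.sum_div, hwsum, Finset.sum_const, Finset.card_univ,
      Fintype.card_fin, nsmul_eq_mul] at hge
    have h := mul_le_mul_of_nonneg_left (hge.trans (hsum ▸ hle)) ht.le
    have h1 : t * (1 / t - m * P.real (B t)) = 1 - m * (t * P.real (B t)) := by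
      field_simp
    linarith
  · filter_upwards [hev] with t ⟨ht1, he0, he1⟩
    have ht : 0 < t := by linarith
    have he : 0 < 1 - η t := by linarith
    change t * P.real {ω | t < ∑ j, w j / p j ω} ≤ _
    have hle : P.real {ω | t < ∑ j, w j / p j ω} ≤
        P.real ((⋃ i, {ω | p i ω < w i / ((1 - η t) * t)}) ∪ B t) := by
      refine ENNReal.toReal_mono (measure_ne_top _ _) (measure_mono_ae ?_)
      filter_upwards [hpos] with ω hω hmem
      by_cases hB : ω ∈ B t
      · exact Or.inr hB
      left
      obtain ⟨i, hi⟩ := det_upper m hm (fun j => w j / p j ω) t (η t) ht he0 hmem (by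
        rintro i j hij ⟨h1, h2⟩
        apply hB
        refine Set.mem_iUnion.2 ⟨i, Set.mem_iUnion.2 ⟨j, hij, ?_, ?_⟩⟩
        · rw [div_lt_div_iff₀ hm0 (hω i)] at h1
          rw [lt_div_iff₀ ht]; linarith
        · rw [div_lt_div_iff₀ hm0 (hω j)] at h2
          rw [lt_div_iff₀ (by positivity)]; linarith)
      refine Set.mem_iUnion.2 ⟨i, ?_⟩
      change p i ω < w i / ((1 - η t) * t)
      rw [lt_div_iff₀ (hω i)] at hi
      rw [lt_div_iff₀ (by positivity)]; linarith
    have h2 : P.real (⋃ i, {ω | p i ω < w i / ((1 - η t) * t)}) ≤ 1 / ((1 - η t) * t) := by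
      have h0 : 1 / ((1 - η t) * t) = ∑ i, w i / ((1 - η t) * t) := by
        rw [← Finset.sum_div, hwsum]
      rw [h0]
      refine (measureReal_iUnion_fintype_le _).trans (Finset.sum_le_sum fun i _ => ?_)
      exact unif_le P (p i) (hmeas i) (hunif i) _ (div_nonneg (hw i).le (mul_pos he ht).le)
    have h3 := hle.trans ((measureReal_union_le _ _).trans (add_le_add_left h2 _))
    have h := mul_le_mul_of_nonneg_left h3 ht.le
    have h1 : t * (1 / ((1 - η t) * t) + P.real (B t)) = (1 - η t)⁻¹ + t * P.real (B t) := by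
      field_simp
    linarith
end

section
/- Let m ≥ 1 and w_1,…,w_m > 0 with ∑_{i=1}^m w_i = 1. Let Z_1,…,Z_m be random variables on a common probability space such that each Z_i has the standard normal distribution and, for every i ≠ j, the joint law of (Z_i, Z_j) equals the law of (W_1, ρ_{ij} W_1 + √(1 − ρ_{ij}²) W_2), where W_1, W_2 are independent standard normal variables, for some ρ_{ij} ∈ (−1,1) with max_{i≠j} |ρ_{ij}| < 1. Set p_i = 1 − Φ(Z_i), where Φ is the standard normal CDF. Then lim_{t→∞} t · P(∑_{i=1}^m w_i cot(π p_i/2) > t) = 2/π. -/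
open MeasureTheory Real ProbabilityTheory Filter

/-- The standard normal CDF. -/
noncomputable def stdNormalCDF (x : ℝ) : ℝ :=
  ∫ t in Set.Iic x, (1 / Real.sqrt (2 * π)) * Real.exp (-t ^ 2 / 2)

/-- The bivariate normal law on `ℝ × ℝ` of `(W₁, ρ W₁ + √(1−ρ²) W₂)` for independent standard
normal `W₁, W₂`, i.e. standard marginals and correlation `ρ`. -/
noncomputable def biNormal (ρ : ℝ) : Measure (ℝ × ℝ) :=
  Measure.map (fun v : ℝ × ℝ => (v.1, ρ * v.1 + Real.sqrt (1 - ρ ^ 2) * v.2))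
    ((gaussianReal 0 1).prod (gaussianReal 0 1))

lemma stdNormalCDF_eq_real (x : ℝ) : stdNormalCDF x = (gaussianReal 0 1).real (Set.Iic x) := by
  rw [Measure.real, gaussianReal_apply_eq_integral 0 one_ne_zero, ENNReal.toReal_ofReal]
  · unfold stdNormalCDF
    congr 1
    ext t
    simp [gaussianPDFReal]
  · exact integral_nonneg fun t => gaussianPDFReal_nonneg _ _ _

lemma stdNormalCDF_eq_cdf (x : ℝ) : stdNormalCDF x = cdf (gaussianReal 0 1) x := by
  rw [stdNormalCDF_eq_real, cdf_eq_real]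

lemma one_sub_stdNormalCDF (x : ℝ) :
    1 - stdNormalCDF x = (gaussianReal 0 1).real (Set.Ioi x) := by
  rw [stdNormalCDF_eq_real, ← Set.compl_Iic, probReal_compl_eq_one_sub measurableSet_Iic]

lemma continuous_stdNormalCDF : Continuous stdNormalCDF := by
  have hint : Integrable (fun t : ℝ => (1 / Real.sqrt (2 * π)) * Real.exp (-t ^ 2 / 2)) := by
    have := integrable_gaussianPDFReal 0 1
    refine this.congr (Filter.Eventually.of_forall fun t => ?_)
    simp [gaussianPDFReal]
  have h : stdNormalCDF = fun x => stdNormalCDF 0 +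
      ∫ t in (0:ℝ)..x, (1 / Real.sqrt (2 * π)) * Real.exp (-t ^ 2 / 2) := by
    ext x
    rw [← intervalIntegral.integral_Iic_sub_Iic hint.integrableOn hint.integrableOn]
    simp only [stdNormalCDF]
    ring
  rw [h]
  exact continuous_const.add
    (intervalIntegral.continuous_primitive (fun a b => hint.intervalIntegrable) 0)

lemma gaussian_tail_lower {a : ℝ} (ha : 0 ≤ a) :
    (1 / Real.sqrt (2 * π)) * Real.exp (-(a + 1) ^ 2 / 2) ≤ (gaussianReal 0 1).real (Set.Ioi a) := by
  have h1 : (gaussianReal 0 1).real (Set.Ioc a (a + 1)) ≤ (gaussianReal 0 1).real (Set.Ioi a) :=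
    measureReal_mono Set.Ioc_subset_Ioi_self
  refine le_trans ?_ h1
  rw [Measure.real, gaussianReal_apply_eq_integral 0 one_ne_zero, ENNReal.toReal_ofReal
    (integral_nonneg fun t => gaussianPDFReal_nonneg _ _ _)]
  have := setIntegral_ge_of_const_le_real (μ := volume) (s := Set.Ioc a (a + 1))
    (f := gaussianPDFReal 0 1) (c := (1 / Real.sqrt (2 * π)) * Real.exp (-(a + 1) ^ 2 / 2))
    measurableSet_Ioc (by simp) (fun x hx => ?_) (integrable_gaussianPDFReal 0 1).integrableOn
  · simpa using this
  · simp only [gaussianPDFReal, NNReal.coe_one, mul_one, sub_zero, one_div]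
    gcongr
    · linarith [hx.1]
    · exact hx.2

lemma gaussian_tail_pos (a : ℝ) : 0 < (gaussianReal 0 1).real (Set.Ioi a) := by
  have h : (gaussianReal 0 1).real (Set.Ioi (max a 0)) ≤ (gaussianReal 0 1).real (Set.Ioi a) :=
    measureReal_mono (Set.Ioi_subset_Ioi (le_max_left _ _))
  refine lt_of_lt_of_le ?_ h
  refine lt_of_lt_of_le ?_ (gaussian_tail_lower (le_max_right _ _))
  positivity

lemma strictMono_stdNormalCDF : StrictMono stdNormalCDF := by
  intro a b hab
  rw [stdNormalCDF_eq_real, stdNormalCDF_eq_real]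
  have h0 : 0 < (gaussianReal 0 1) (Set.Ioc a b) := by
    rw [pos_iff_ne_zero]
    intro h
    have := gaussianReal_absolutelyContinuous' 0 one_ne_zero h
    simp at this
    linarith
  have h1 : 0 < (gaussianReal 0 1).real (Set.Ioc a b) :=
    ENNReal.toReal_pos h0.ne' (measure_ne_top _ _)
  rw [← Set.Iic_union_Ioc_eq_Iic hab.le, measureReal_union (Set.Iic_disjoint_Ioc le_rfl)
    measurableSet_Ioc]
  linarith

lemma stdNormalCDF_lt_one (x : ℝ) : stdNormalCDF x < 1 := by
  have := gaussian_tail_pos x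
  rw [← one_sub_stdNormalCDF] at this
  linarith

lemma stdNormalCDF_pos (x : ℝ) : 0 < stdNormalCDF x := by
  have : stdNormalCDF (x - 1) < stdNormalCDF x := strictMono_stdNormalCDF (by linarith)
  refine lt_of_le_of_lt ?_ this
  rw [stdNormalCDF_eq_real]
  exact measureReal_nonneg

lemma exists_stdNormalCDF_eq {q : ℝ} (h0 : 0 < q) (h1 : q < 1) :
    ∃ u, stdNormalCDF u = q := by
  have heq : stdNormalCDF = cdf (gaussianReal 0 1) := funext stdNormalCDF_eq_cdf
  obtain ⟨a, ha⟩ := ((tendsto_cdf_atBot (gaussianReal 0 1)).eventually (gt_mem_nhds h0)).exists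
  obtain ⟨b, hb⟩ := ((tendsto_cdf_atTop (gaussianReal 0 1)).eventually (lt_mem_nhds h1)).exists
  exact mem_range_of_exists_le_of_exists_ge continuous_stdNormalCDF
    ⟨a, by rw [heq]; exact ha.le⟩ ⟨b, by rw [heq]; exact hb.le⟩

/-- The half-Cauchy score of a normal statistic. -/
noncomputable def hcScore (x : ℝ) : ℝ := Real.cot (π * (1 - stdNormalCDF x) / 2)

lemma hcScore_arg (x : ℝ) : 0 < π * (1 - stdNormalCDF x) / 2 ∧
    π * (1 - stdNormalCDF x) / 2 < π / 2 := by
  have h1 := stdNormalCDF_lt_one x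
  have h2 := stdNormalCDF_pos x
  have := Real.pi_pos
  constructor
  · have : 0 < 1 - stdNormalCDF x := by linarith
    positivity
  · nlinarith

lemma hcScore_pos (x : ℝ) : 0 < hcScore x := by
  obtain ⟨h1, h2⟩ := hcScore_arg x
  rw [hcScore, ← Real.tan_inv_eq_cot]
  exact inv_pos.2 (Real.tan_pos_of_pos_of_lt_pi_div_two h1 h2)

lemma lt_hcScore_iff {s : ℝ} (hs : 0 < s) (x : ℝ) :
    s < hcScore x ↔ π * (1 - stdNormalCDF x) / 2 < Real.arctan s⁻¹ := by
  obtain ⟨h1, h2⟩ := hcScore_arg x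
  have h3 := Real.tan_pos_of_pos_of_lt_pi_div_two h1 h2
  rw [hcScore, ← Real.tan_inv_eq_cot, lt_inv_comm₀ hs h3]
  conv_rhs => rw [← Real.arctan_tan (x := π * (1 - stdNormalCDF x) / 2) (by linarith) h2]
  exact Real.arctan_strictMono.lt_iff_lt.symm

lemma exists_threshold {s : ℝ} (hs : 0 < s) :
    ∃ u, (gaussianReal 0 1).real (Set.Ioi u) = 2 / π * Real.arctan s⁻¹ ∧
      ∀ x, s < hcScore x ↔ u < x := by
  have hpi := Real.pi_pos
  have ha : 0 < Real.arctan s⁻¹ := by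
    rw [← Real.arctan_zero]; exact Real.arctan_strictMono (inv_pos.2 hs)
  have hb := Real.arctan_lt_pi_div_two s⁻¹
  have hq0 : 0 < 2 / π * Real.arctan s⁻¹ := by positivity
  have hq1 : 2 / π * Real.arctan s⁻¹ < 1 := by
    rw [div_mul_eq_mul_div, div_lt_one hpi]; linarith
  obtain ⟨u, hu⟩ := exists_stdNormalCDF_eq (q := 1 - 2 / π * Real.arctan s⁻¹) (by linarith)
    (by linarith)
  refine ⟨u, ?_, fun x => ?_⟩
  · rw [← one_sub_stdNormalCDF, hu]; ring
  · rw [lt_hcScore_iff hs, ← strictMono_stdNormalCDF.lt_iff_lt (a := u) (b := x), hu]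
    have e : Real.arctan s⁻¹ = π * (2 / π * Real.arctan s⁻¹) / 2 := by field_simp
    constructor
    · intro h
      rw [e] at h
      have := lt_of_mul_lt_mul_left (by linarith : π * (1 - stdNormalCDF x) <
        π * (2 / π * Real.arctan s⁻¹)) hpi.le
      linarith
    · intro h
      rw [e]
      have := mul_lt_mul_of_pos_left (by linarith : (1 - stdNormalCDF x) <
        (2 / π * Real.arctan s⁻¹)) hpi
      linarith

lemma tendsto_mul_arctan_inv :
    Tendsto (fun s : ℝ => s * (2 / π * Real.arctan s⁻¹)) atTop (nhds (2 / π)) := by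
  have h := (Real.hasDerivAt_arctan 0).tendsto_slope
  have h2 : Tendsto (fun s : ℝ => s⁻¹) atTop (nhdsWithin 0 {0}ᶜ) := by
    refine tendsto_inv_atTop_nhdsGT_zero.mono_right (nhdsWithin_mono _ ?_)
    intro x hx; exact ne_of_gt hx
  have h3 := (h.comp h2).const_mul (2 / π)
  simp only [ne_eq, OfNat.ofNat_ne_zero, not_false_eq_true, zero_pow, add_zero, div_one,
    mul_one] at h3
  refine h3.congr fun s => ?_
  simp [slope_def_field]
  ring

lemma biNormal_tail_le {r : ℝ} (hr : |r| < 1) {a : ℝ} (ha : 0 ≤ a) :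
    (biNormal r).real {v | a < v.1 ∧ a < v.2} ≤ Real.exp (-(a ^ 2 / (1 + r))) := by
  obtain ⟨hr1, hr2⟩ := abs_lt.1 hr
  set G := gaussianReal 0 1 with hG
  set c := Real.sqrt (1 - r ^ 2) with hc
  have hc2 : c ^ 2 = 1 - r ^ 2 := Real.sq_sqrt (by nlinarith)
  have hpos : 0 < 1 + r := by linarith
  set l := a / (1 + r) with hl
  have hms : MeasurableSet {v : ℝ × ℝ | a < v.1 ∧ a < v.2} :=
    (measurableSet_lt measurable_const measurable_fst).inter
      (measurableSet_lt measurable_const measurable_snd)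
  have e : (biNormal r).real {v | a < v.1 ∧ a < v.2} =
      (G.prod G).real {v | a < v.1 ∧ a < r * v.1 + c * v.2} := by
    rw [biNormal, map_measureReal_apply (by fun_prop) hms]
    rfl
  have e2 : (G.prod G).real {v | a < v.1 ∧ a < r * v.1 + c * v.2} ≤
      (G.prod G).real {v | 2 * a ≤ (1 + r) * v.1 + c * v.2} := by
    refine measureReal_mono ?_
    intro v hv
    have h1 := hv.1
    have h2 := hv.2
    change 2 * a ≤ (1 + r) * v.1 + c * v.2
    linarith
  rw [e]
  refine e2.trans ?_
  have hfun : ∀ v : ℝ × ℝ, Real.exp (l * ((1 + r) * v.1 + c * v.2)) =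
      Real.exp ((l * (1 + r)) * v.1) * Real.exp ((l * c) * v.2) := by
    intro v; rw [← Real.exp_add]; ring_nf
  have hint : Integrable (fun v : ℝ × ℝ => Real.exp (l * ((1 + r) * v.1 + c * v.2)))
      (G.prod G) := by
    simp_rw [hfun]
    exact Integrable.mul_prod (integrable_exp_mul_gaussianReal _)
      (integrable_exp_mul_gaussianReal _)
  have := measure_ge_le_exp_mul_mgf (μ := G.prod G)
    (X := fun v : ℝ × ℝ => (1 + r) * v.1 + c * v.2) (2 * a) (by positivity : 0 ≤ l) hint
  refine this.trans_eq ?_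
  have hm : ∀ t : ℝ, ∫ x, Real.exp (t * x) ∂G = Real.exp (t ^ 2 / 2) := by
    intro t
    have := congrFun (mgf_fun_id_gaussianReal (μ := 0) (v := 1)) t
    simpa [mgf] using this
  have hmgf : mgf (fun v : ℝ × ℝ => (1 + r) * v.1 + c * v.2) (G.prod G) l =
      Real.exp ((l * (1 + r)) ^ 2 / 2) * Real.exp ((l * c) ^ 2 / 2) := by
    simp only [mgf]
    simp_rw [hfun]
    rw [integral_prod_mul (fun x => Real.exp ((l * (1 + r)) * x))
      (fun x => Real.exp ((l * c) * x)), hm, hm]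
  rw [hmgf, ← Real.exp_add, ← Real.exp_add]
  congr 1
  rw [mul_pow l c, hc2, hl]
  field_simp
  ring

lemma biNormal_ratio_tendsto {r : ℝ} (hr : |r| < 1) :
    Tendsto (fun a => (biNormal r).real {v | a < v.1 ∧ a < v.2} /
      (gaussianReal 0 1).real (Set.Ioi a)) atTop (nhds 0) := by
  obtain ⟨hr1, hr2⟩ := abs_lt.1 hr
  have hpos : 0 < 1 + r := by linarith
  set k := 1 / (1 + r) - 1 / 2 with hk
  have hk0 : 0 < k := by
    rw [hk, sub_pos]
    exact one_div_lt_one_div_of_lt hpos (by linarith)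
  have hlim : Tendsto (fun a : ℝ => Real.sqrt (2 * π) * Real.exp (-(a * (k * a - 1) - 1 / 2)))
      atTop (nhds 0) := by
    have h1 : Tendsto (fun a : ℝ => a * (k * a - 1) - 1 / 2) atTop atTop := by
      refine tendsto_atTop_add_const_right _ _ ?_
      refine tendsto_id.atTop_mul_atTop₀ ?_
      exact tendsto_atTop_add_const_right _ _ (tendsto_id.const_mul_atTop hk0)
    simpa using (Real.tendsto_exp_neg_atTop_nhds_zero.comp h1).const_mul (Real.sqrt (2 * π))
  refine squeeze_zero' (Eventually.of_forall fun a => div_nonneg measureReal_nonneg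
    measureReal_nonneg) ?_ hlim
  filter_upwards [eventually_ge_atTop 0] with a ha
  have hg := gaussian_tail_lower ha
  have hb := biNormal_tail_le hr ha
  calc _ ≤ Real.exp (-(a ^ 2 / (1 + r))) /
        ((1 / Real.sqrt (2 * π)) * Real.exp (-(a + 1) ^ 2 / 2)) := by
        gcongr
    _ = Real.sqrt (2 * π) * (Real.exp (-(a ^ 2 / (1 + r))) / Real.exp (-(a + 1) ^ 2 / 2)) := by
        have : 0 < Real.sqrt (2 * π) := by positivity
        field_simp
    _ = _ := by
        rw [← Real.exp_sub]
        congr 2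
        rw [hk]
        field_simp
        ring

lemma measurable_hcScore : Measurable hcScore := by
  have h := continuous_stdNormalCDF.measurable
  unfold hcScore
  simp_rw [Real.cot_eq_cos_div_sin]
  fun_prop

lemma single_tail {Ω : Type*} [MeasurableSpace Ω] (P : Measure Ω) {X : Ω → ℝ}
    (hX : Measurable X) (hlaw : Measure.map X P = gaussianReal 0 1) {s : ℝ} (hs : 0 < s) :
    P.real {ω | s < hcScore (X ω)} = 2 / π * Real.arctan s⁻¹ := by
  obtain ⟨u, hu, hiff⟩ := exists_threshold hs
  rw [← hu, ← hlaw, map_measureReal_apply hX measurableSet_Ioi]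
  congr 1
  ext ω
  exact hiff (X ω)

lemma single_scaled {Ω : Type*} [MeasurableSpace Ω] (P : Measure Ω) {X : Ω → ℝ}
    (hX : Measurable X) (hlaw : Measure.map X P = gaussianReal 0 1) {c a : ℝ} (hc : 0 < c)
    (ha : 0 < a) :
    Tendsto (fun t => t * P.real {ω | c * t < a * hcScore (X ω)}) atTop
      (nhds (2 / π * (a / c))) := by
  have h1 : Tendsto (fun t : ℝ => c / a * t) atTop atTop :=
    tendsto_id.const_mul_atTop (by positivity)
  refine ((tendsto_mul_arctan_inv.comp h1).mul_const (a / c)).congr' ?_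
  filter_upwards [eventually_gt_atTop 0] with t ht
  have hs : 0 < c / a * t := by positivity
  have e : {ω | c * t < a * hcScore (X ω)} = {ω | c / a * t < hcScore (X ω)} := by
    ext ω
    change c * t < a * hcScore (X ω) ↔ c / a * t < hcScore (X ω)
    rw [div_mul_eq_mul_div, div_lt_iff₀' ha]
  rw [e, single_tail P hX hlaw hs]
  simp only [Function.comp]
  generalize Real.arctan (c / a * t)⁻¹ = y
  field_simp

lemma pair_tail {Ω : Type*} [MeasurableSpace Ω] (P : Measure Ω) {X Y : Ω → ℝ}
    (hX : Measurable X) (hY : Measurable Y) {r : ℝ} (hr : |r| < 1)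
    (hlaw : Measure.map (fun ω => (X ω, Y ω)) P = biNormal r) :
    Tendsto (fun s => s * P.real {ω | s < hcScore (X ω) ∧ s < hcScore (Y ω)}) atTop
      (nhds 0) := by
  have hex : ∀ s : ℝ, ∃ u, 0 < s → ((gaussianReal 0 1).real (Set.Ioi u) =
      2 / π * Real.arctan s⁻¹ ∧ ∀ x, s < hcScore x ↔ u < x) := by
    intro s
    by_cases hs : 0 < s
    · obtain ⟨u, hu⟩ := exists_threshold hs
      exact ⟨u, fun _ => hu⟩
    · exact ⟨0, fun h => absurd h hs⟩
  choose u hu using hex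
  have hq : Tendsto (fun s : ℝ => 2 / π * Real.arctan s⁻¹) atTop (nhds 0) := by
    have := (Real.continuous_arctan.tendsto 0).comp tendsto_inv_atTop_zero
    rw [Real.arctan_zero] at this
    simpa using this.const_mul (2 / π)
  have hutop : Tendsto u atTop atTop := by
    rw [tendsto_atTop]
    intro b
    filter_upwards [hq.eventually (gt_mem_nhds (gaussian_tail_pos b)), eventually_gt_atTop 0]
      with s hs hs0
    rw [← (hu s hs0).1] at hs
    by_contra hlt
    have : (gaussianReal 0 1).real (Set.Ioi b) ≤ (gaussianReal 0 1).real (Set.Ioi (u s)) :=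
      measureReal_mono (Set.Ioi_subset_Ioi (not_le.1 hlt).le)
    linarith
  have h := tendsto_mul_arctan_inv.mul ((biNormal_ratio_tendsto hr).comp hutop)
  rw [mul_zero] at h
  refine h.congr' ?_
  filter_upwards [eventually_gt_atTop 0] with s hs
  obtain ⟨h1, h2⟩ := hu s hs
  have hms : MeasurableSet {v : ℝ × ℝ | u s < v.1 ∧ u s < v.2} :=
    (measurableSet_lt measurable_const measurable_fst).inter
      (measurableSet_lt measurable_const measurable_snd)
  have e : P.real {ω | s < hcScore (X ω) ∧ s < hcScore (Y ω)} =
      (biNormal r).real {v | u s < v.1 ∧ u s < v.2} := by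
    rw [← hlaw, map_measureReal_apply (hX.prodMk hY) hms]
    congr 1
    ext ω
    exact and_congr (h2 _) (h2 _)
  have hp := gaussian_tail_pos (u s)
  simp only [Function.comp]
  rw [e, ← h1]
  field_simp

lemma pair_scaled {Ω : Type*} [MeasurableSpace Ω] (P : Measure Ω) [IsProbabilityMeasure P]
    {X Y : Ω → ℝ} (hX : Measurable X) (hY : Measurable Y) {r : ℝ} (hr : |r| < 1)
    (hlaw : Measure.map (fun ω => (X ω, Y ω)) P = biNormal r) {c a b : ℝ} (hc : 0 < c)
    (_ha : 0 < a) (ha1 : a ≤ 1) (_hb : 0 < b) (hb1 : b ≤ 1) :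
    Tendsto (fun t => t * P.real {ω | c * t < a * hcScore (X ω) ∧ c * t < b * hcScore (Y ω)})
      atTop (nhds 0) := by
  have h1 : Tendsto (fun t : ℝ => c * t) atTop atTop := tendsto_id.const_mul_atTop hc
  have h2 := ((pair_tail P hX hY hr hlaw).comp h1).const_mul c⁻¹
  rw [mul_zero] at h2
  refine squeeze_zero' ?_ ?_ h2
  · filter_upwards [eventually_ge_atTop 0] with t ht
    exact mul_nonneg ht measureReal_nonneg
  · filter_upwards [eventually_ge_atTop 0] with t ht
    simp only [Function.comp]
    rw [← mul_assoc, inv_mul_cancel_left₀ hc.ne']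
    refine mul_le_mul_of_nonneg_left (measureReal_mono ?_) ht
    rintro ω ⟨h3, h4⟩
    have := hcScore_pos (X ω)
    have := hcScore_pos (Y ω)
    exact ⟨by nlinarith, by nlinarith⟩

lemma bonferroni_lower {Ω : Type*} [MeasurableSpace Ω] (P : Measure Ω) [IsProbabilityMeasure P]
    {m : ℕ} (A : Fin m → Set Ω) (hA : ∀ i, MeasurableSet (A i)) :
    ∑ i, P.real (A i) - ∑ i, ∑ j ∈ Finset.univ.erase i, P.real (A i ∩ A j) ≤
      P.real (⋃ i, A i) := by
  classical
  let B : Fin m → Set Ω := fun i => A i \ ⋃ j ∈ Finset.univ.erase i, A j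
  have hB : ∀ i, MeasurableSet (B i) := fun i =>
    (hA i).diff (Finset.measurableSet_biUnion _ fun j _ => hA j)
  have hdisj : Pairwise (Function.onFun Disjoint B) := by
    intro i j hij
    refine Set.disjoint_left.2 fun ω hi hj => hi.2 ?_
    exact Set.mem_iUnion₂.2 ⟨j, Finset.mem_erase.2 ⟨hij.symm, Finset.mem_univ _⟩, hj.1⟩
  have h1 : ∑ i, P.real (B i) ≤ P.real (⋃ i, A i) := by
    rw [← measureReal_iUnion_fintype hdisj hB]
    exact measureReal_mono (Set.iUnion_mono fun i => Set.diff_subset)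
  refine le_trans ?_ h1
  rw [← Finset.sum_sub_distrib]
  refine Finset.sum_le_sum fun i _ => ?_
  have h2 : P.real (A i) ≤ P.real (B i ∪ ⋃ j ∈ Finset.univ.erase i, (A i ∩ A j)) := by
    refine measureReal_mono fun ω hω => ?_
    by_cases h : ω ∈ ⋃ j ∈ Finset.univ.erase i, A j
    · obtain ⟨j, hj, hωj⟩ := Set.mem_iUnion₂.1 h
      exact Or.inr (Set.mem_iUnion₂.2 ⟨j, hj, hω, hωj⟩)
    · exact Or.inl ⟨hω, h⟩
  have h3 := h2.trans (measureReal_union_le _ _)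
  have h4 := measureReal_biUnion_finset_le (μ := P) (Finset.univ.erase i) (fun j => A i ∩ A j)
  linarith

lemma sum_split {m : ℕ} [Nonempty (Fin m)] (y : Fin m → ℝ) {δ t : ℝ} (hδ0 : 0 < δ) (hδ1 : δ < 1)
    (ht : 0 < t) (h : t < ∑ i, y i) :
    (∃ i, (1 - δ) * t < y i) ∨ ∃ i j, i ≠ j ∧ δ / m * t < y i ∧ δ / m * t < y j := by
  classical
  have hm : (0 : ℝ) < m := by
    have : 0 < m := Fin.pos_iff_nonempty.2 inferInstance
    exact_mod_cast this
  by_contra hcon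
  push Not at hcon
  obtain ⟨h1, h2⟩ := hcon
  obtain ⟨i, hi⟩ := Finite.exists_max y
  have h3 : δ / m * t < y i := by
    have : ∑ j, y j ≤ ∑ _j : Fin m, y i := Finset.sum_le_sum fun j _ => hi j
    rw [Finset.sum_const, Finset.card_univ, Fintype.card_fin, nsmul_eq_mul] at this
    rw [div_mul_eq_mul_div, div_lt_iff₀' hm]
    nlinarith
  have h4 : ∑ j ∈ Finset.univ.erase i, y j ≤ ∑ j ∈ Finset.univ.erase i, δ / m * t :=
    Finset.sum_le_sum fun j hj => h2 i j (Finset.ne_of_mem_erase hj).symm h3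
  have h5 : ∑ j ∈ Finset.univ.erase i, δ / m * t ≤ ∑ _j : Fin m, δ / m * t :=
    Finset.sum_le_sum_of_subset_of_nonneg (Finset.erase_subset _ _) fun _ _ _ => by positivity
  have h6 : ∑ _j : Fin m, δ / m * t = δ * t := by
    rw [Finset.sum_const, Finset.card_univ, Fintype.card_fin, nsmul_eq_mul]
    field_simp
  have h7 := Finset.add_sum_erase Finset.univ y (Finset.mem_univ i)
  have h8 := h1 i
  linarith

/-- Corollary 5.6 (fixed-m, one-sided case): for standard normal test statistics with pairwise
bivariate-normal dependence and correlations bounded away from ±1, the HCCT statistic has the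
standard Half-Cauchy leading tail: `lim t·P(T_HCCT > t) = 2/π`. -/
theorem hcct_tail_bivariate_normal
    (m : ℕ) (hm : 1 ≤ m)
    (w : Fin m → ℝ) (hw : ∀ i, 0 < w i) (hwsum : ∑ i, w i = 1)
    (Ω : Type*) [MeasurableSpace Ω] (P : Measure Ω) [IsProbabilityMeasure P]
    (Z : Fin m → Ω → ℝ) (hmeas : ∀ i, Measurable (Z i))
    (hmarg : ∀ i, Measure.map (Z i) P = gaussianReal 0 1)
    (ρ : Fin m → Fin m → ℝ) (hρ : ∀ i j, i ≠ j → |ρ i j| < 1)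
    (hjoint : ∀ i j, i ≠ j →
      Measure.map (fun ω => (Z i ω, Z j ω)) P = biNormal (ρ i j)) :
    Tendsto (fun t => t *
        (P {ω | t < ∑ i, w i * Real.cot (π * (1 - stdNormalCDF (Z i ω)) / 2)}).toReal)
      atTop (nhds (2 / π)) := by
  classical
  have : Nonempty (Fin m) := ⟨⟨0, hm⟩⟩
  have hpi := Real.pi_pos
  have hmpos : (0 : ℝ) < m := by exact_mod_cast hm
  change Tendsto (fun t => t * P.real {ω | t < ∑ i, w i * hcScore (Z i ω)}) atTop (nhds (2 / π))
  have hw1 : ∀ i, w i ≤ 1 := fun i => by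
    rw [← hwsum]
    exact Finset.single_le_sum (fun j _ => (hw j).le) (Finset.mem_univ i)
  have hy : ∀ i ω, 0 < w i * hcScore (Z i ω) := fun i ω => mul_pos (hw i) (hcScore_pos _)
  have hsing : ∀ c : ℝ, 0 < c → Tendsto (fun t => ∑ i, t * P.real
      {ω | c * t < w i * hcScore (Z i ω)}) atTop (nhds (2 / π / c)) := by
    intro c hc
    have : 2 / π / c = ∑ i, 2 / π * (w i / c) := by
      rw [← Finset.mul_sum, ← Finset.sum_div, hwsum]; ring
    rw [this]
    exact tendsto_finsetSum _ fun i _ => single_scaled P (hmeas i) (hmarg i) hc (hw i)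
  have hpair : ∀ c : ℝ, 0 < c → Tendsto (fun t => ∑ i, ∑ j ∈ Finset.univ.erase i, t * P.real
      {ω | c * t < w i * hcScore (Z i ω) ∧ c * t < w j * hcScore (Z j ω)}) atTop (nhds 0) := by
    intro c hc
    have : (0 : ℝ) = ∑ i : Fin m, ∑ j ∈ Finset.univ.erase i, 0 := by simp
    rw [this]
    refine tendsto_finsetSum _ fun i _ => tendsto_finsetSum _ fun j hj => ?_
    have hij : i ≠ j := (Finset.ne_of_mem_erase hj).symm
    exact pair_scaled P (hmeas i) (hmeas j) (hρ i j hij) (hjoint i j hij) hc (hw i) (hw1 i)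
      (hw j) (hw1 j)
  rw [tendsto_order]
  constructor
  · intro a ha
    have hl := (hsing 1 one_pos).sub (hpair 1 one_pos)
    rw [div_one, sub_zero] at hl
    filter_upwards [hl.eventually (lt_mem_nhds ha), eventually_ge_atTop 0] with t ht ht0
    refine ht.trans_le ?_
    have hb := bonferroni_lower P (fun i => {ω | 1 * t < w i * hcScore (Z i ω)})
      (fun i => measurableSet_lt measurable_const
        ((measurable_hcScore.comp (hmeas i)).const_mul _))
    have hsub : P.real (⋃ i, {ω | 1 * t < w i * hcScore (Z i ω)}) ≤
        P.real {ω | t < ∑ i, w i * hcScore (Z i ω)} := by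
      refine measureReal_mono ?_
      intro ω hω
      obtain ⟨i, hi⟩ := Set.mem_iUnion.1 hω
      have hi' : 1 * t < w i * hcScore (Z i ω) := hi
      change t < ∑ i, w i * hcScore (Z i ω)
      rw [one_mul] at hi'
      exact hi'.trans_le (Finset.single_le_sum (f := fun i => w i * hcScore (Z i ω))
        (fun j _ => (hy j ω).le) (Finset.mem_univ i))
    have := mul_le_mul_of_nonneg_left (hb.trans hsub) ht0
    rw [mul_sub, Finset.mul_sum, Finset.mul_sum] at this
    simp_rw [Finset.mul_sum] at this
    exact this
  · intro b hb
    have hb0 : 0 < b := lt_trans (by positivity) hb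
    obtain ⟨δ, hδ0, hδ1, hδb⟩ : ∃ δ : ℝ, 0 < δ ∧ δ < 1 ∧ 2 / π / (1 - δ) < b := by
      have hx : 2 / π / b < 1 := (div_lt_one hb0).2 hb
      have hx0 : 0 < 2 / π / b := by positivity
      refine ⟨(1 - 2 / π / b) / 2, by linarith, by linarith, ?_⟩
      rw [div_lt_comm₀ (by linarith) hb0]
      linarith
    have hu := (hsing (1 - δ) (by linarith)).add (hpair (δ / m) (by positivity))
    rw [add_zero] at hu
    filter_upwards [hu.eventually (gt_mem_nhds hδb), eventually_gt_atTop 0] with t ht ht0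
    refine lt_of_le_of_lt ?_ ht
    have hsub : {ω | t < ∑ i, w i * hcScore (Z i ω)} ⊆
        (⋃ i, {ω | (1 - δ) * t < w i * hcScore (Z i ω)}) ∪
        ⋃ i, ⋃ j ∈ Finset.univ.erase i, {ω | δ / m * t < w i * hcScore (Z i ω) ∧
          δ / m * t < w j * hcScore (Z j ω)} := by
      intro ω hω
      rcases sum_split (fun i => w i * hcScore (Z i ω)) hδ0 hδ1 ht0 hω with ⟨i, hi⟩ | ⟨i, j, hij, h⟩
      · exact Or.inl (Set.mem_iUnion.2 ⟨i, hi⟩)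
      · refine Or.inr (Set.mem_iUnion.2 ⟨i, Set.mem_iUnion₂.2 ⟨j, ?_, h⟩⟩)
        exact Finset.mem_erase.2 ⟨hij.symm, Finset.mem_univ _⟩
    have h1 : P.real {ω | t < ∑ i, w i * hcScore (Z i ω)} ≤
        ∑ i, P.real {ω | (1 - δ) * t < w i * hcScore (Z i ω)} +
        ∑ i, ∑ j ∈ Finset.univ.erase i, P.real {ω | δ / m * t < w i * hcScore (Z i ω) ∧
          δ / m * t < w j * hcScore (Z j ω)} := by
      refine (measureReal_mono hsub).trans ((measureReal_union_le _ _).trans ?_)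
      refine add_le_add (measureReal_iUnion_fintype_le _) ?_
      refine (measureReal_iUnion_fintype_le _).trans (Finset.sum_le_sum fun i _ => ?_)
      exact measureReal_biUnion_finset_le _ _
    have := mul_le_mul_of_nonneg_left h1 ht0.le
    rw [mul_add, Finset.mul_sum, Finset.mul_sum] at this
    simp_rw [Finset.mul_sum] at this
    exact this
end

section
/- Let g : ℝ → ℝ be continuous, even (g(−θ) = g(θ) for all θ ∈ ℝ), and not convex. Then there exist θ_0 ∈ ℝ, θ_1 ≠ 0 and c ∈ ℝ such that, setting h(θ) = (g(θ − θ_0) + g(θ + θ_0))/2, one has h(θ_1) ≤ c, h(−θ_1) ≤ c, and h(0) > c; in particular the sublevel set {θ ∈ ℝ : h(θ) ≤ c} is nonempty and not convex (it contains θ_1 and −θ_1 but not 0, so it consists of at least two disjoint nonempty pieces). -/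
theorem convexOn_of_midpoint_aux (g : ℝ → ℝ) (hg : Continuous g)
    (hm : ∀ a t : ℝ, g a ≤ (g (a - t) + g (a + t)) / 2) : ConvexOn ℝ Set.univ g := by
  refine ⟨convex_univ, ?_⟩
  intro x _ y _ a b ha hb hab
  simp only [smul_eq_mul]
  obtain ⟨φ, hφ⟩ : ∃ φ : ℝ → ℝ, ∀ s, φ s = g (x + s * (y - x)) - (1 - s) * g x - s * g y :=
    ⟨_, fun _ => rfl⟩
  have hc : Continuous φ := by
    have : φ = fun s => g (x + s * (y - x)) - (1 - s) * g x - s * g y := funext hφ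
    rw [this]; fun_prop
  have h0 : φ 0 = 0 := by rw [hφ]; simp
  have h1 : φ 1 = 0 := by rw [hφ]; simp
  have hmid : ∀ s t : ℝ, φ s ≤ (φ (s - t) + φ (s + t)) / 2 := by
    intro s t
    have h := hm (x + s * (y - x)) (t * (y - x))
    rw [hφ, hφ, hφ]
    have e1 : x + (s - t) * (y - x) = x + s * (y - x) - t * (y - x) := by ring
    have e2 : x + (s + t) * (y - x) = x + s * (y - x) + t * (y - x) := by ring
    rw [e1, e2]
    linarith
  have key : ∀ s ∈ Set.Icc (0 : ℝ) 1, φ s ≤ 0 := by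
    obtain ⟨m, hmI, hmax⟩ := isCompact_Icc.exists_isMaxOn
      (Set.nonempty_Icc.2 (zero_le_one : (0 : ℝ) ≤ 1)) hc.continuousOn
    have hmax' : ∀ s ∈ Set.Icc (0 : ℝ) 1, φ s ≤ φ m := fun s hs => hmax hs
    by_contra hcon
    push Not at hcon
    obtain ⟨s, hs, hpos⟩ := hcon
    have hM : 0 < φ m := hpos.trans_le (hmax' s hs)
    have hS : IsCompact (Set.Icc (0 : ℝ) 1 ∩ {r | φ r = φ m}) :=
      isCompact_Icc.inter_right (isClosed_eq hc continuous_const)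
    obtain ⟨r, ⟨⟨hr0, hr1⟩, hrM⟩, hleast⟩ := hS.exists_isLeast ⟨m, hmI, rfl⟩
    have hrM' : φ r = φ m := hrM
    have hr0' : 0 < r := lt_of_le_of_ne hr0 (by rintro rfl; linarith)
    have hr1' : r < 1 := lt_of_le_of_ne hr1 (by rintro rfl; linarith)
    obtain ⟨t, ht, ht1, ht2⟩ : ∃ t : ℝ, 0 < t ∧ t ≤ r ∧ t ≤ 1 - r :=
      ⟨min r (1 - r), lt_min hr0' (by linarith), min_le_left _ _, min_le_right _ _⟩
    have hI : r - t ∈ Set.Icc (0 : ℝ) 1 := ⟨by linarith, by linarith⟩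
    have hlt : φ (r - t) < φ m := by
      refine lt_of_le_of_ne (hmax' _ hI) fun he => ?_
      have : r ≤ r - t := hleast ⟨hI, he⟩
      linarith
    have hle := hmax' (r + t) ⟨by linarith, by linarith⟩
    have := hmid r t
    linarith
  have h := key b ⟨hb, by linarith⟩
  rw [hφ] at h
  have ea : a = 1 - b := by linarith
  have e : a * x + b * y = x + b * (y - x) := by rw [ea]; ring
  rw [e, ea]
  linarith


/-- Lemma C.1: if `g` is continuous, even and non-convex, then some equally weighted two-point
average `h(θ) = (g(θ−θ₀)+g(θ+θ₀))/2` has a sublevel set containing `θ₁ ≠ 0` and `−θ₁` but not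
`0`; in particular that sublevel set is nonempty and not convex. -/
theorem nonconvex_even_score_gives_disconnected_sublevel
    (g : ℝ → ℝ) (hg : Continuous g)
    (heven : ∀ θ : ℝ, g (-θ) = g θ)
    (hnc : ¬ ConvexOn ℝ Set.univ g) :
    ∃ (θ₀ θ₁ c : ℝ), θ₁ ≠ 0 ∧
      (g (θ₁ - θ₀) + g (θ₁ + θ₀)) / 2 ≤ c ∧
      (g (-θ₁ - θ₀) + g (-θ₁ + θ₀)) / 2 ≤ c ∧
      c < (g (0 - θ₀) + g (0 + θ₀)) / 2 ∧
      ¬ Convex ℝ {θ : ℝ | (g (θ - θ₀) + g (θ + θ₀)) / 2 ≤ c} := by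
  obtain ⟨a, t, hat⟩ : ∃ a t : ℝ, (g (a - t) + g (a + t)) / 2 < g a := by
    by_contra hcon
    push Not at hcon
    exact hnc (convexOn_of_midpoint_aux g hg hcon)
  have e1 : g (t - a) = g (a - t) := by rw [← heven]; congr 1; ring
  have e2 : g (-t - a) = g (a + t) := by rw [← heven]; congr 1; ring
  have e3 : g (t + a) = g (a + t) := by rw [add_comm]
  have e4 : g (-t + a) = g (a - t) := by congr 1; ring
  have e5 : g (0 - a) = g a := by rw [zero_sub, heven]
  have e6 : g (0 + a) = g a := by rw [zero_add]
  have p1 : (g (t - a) + g (t + a)) / 2 ≤ (g (a - t) + g (a + t)) / 2 := by rw [e1, e3]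
  have p2 : (g (-t - a) + g (-t + a)) / 2 ≤ (g (a - t) + g (a + t)) / 2 := by
    rw [e2, e4]; linarith
  have p3 : (g (a - t) + g (a + t)) / 2 < (g (0 - a) + g (0 + a)) / 2 := by
    rw [e5, e6]; linarith
  refine ⟨a, t, (g (a - t) + g (a + t)) / 2, ?_, p1, p2, p3, ?_⟩
  · rintro rfl
    simp at hat
  · intro hconv
    have h := hconv (x := t) p1 (y := -t) p2 (a := 1 / 2) (b := 1 / 2)
      (by norm_num) (by norm_num) (by norm_num)
    have e : (1 / 2 : ℝ) • t + (1 / 2 : ℝ) • (-t) = 0 := by simp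
    rw [e] at h
    exact absurd h (not_le.2 p3)
end

section
/- Let a, b ∈ ℝ, and let F : (a,∞) → (0,1) and G : (b,∞) → (0,1) be strictly increasing, twice continuously differentiable bijections with F′ > 0 and G′ > 0 on their domains; let F^{−1} : (0,1) → (a,∞) and G^{−1} : (0,1) → (b,∞) denote their inverse functions. Then the composition F^{−1} ∘ G is convex on (b,∞) if and only if for every u ∈ (0,1), −F″(F^{−1}(u)) / (F′(F^{−1}(u)))² ≥ −G″(G^{−1}(u)) / (G′(G^{−1}(u)))². -/
/-- Lemma C.3 (convexity criterion): for strictly increasing C² bijections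
`F : (a,∞) → (0,1)` and `G : (b,∞) → (0,1)` with positive derivatives, the composition
`F⁻¹ ∘ G` is convex on `(b,∞)` iff the 𝒯-transforms are ordered:
`−F″(F⁻¹(u))/F′(F⁻¹(u))² ≥ −G″(G⁻¹(u))/G′(G⁻¹(u))²` for all `u ∈ (0,1)`. -/
theorem quantile_composition_convex_iff
    (a b : ℝ) (F G Finv Ginv : ℝ → ℝ)
    (hFmono : StrictMonoOn F (Set.Ioi a)) (hGmono : StrictMonoOn G (Set.Ioi b))
    (hFsmooth : ContDiffOn ℝ 2 F (Set.Ioi a)) (hGsmooth : ContDiffOn ℝ 2 G (Set.Ioi b))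
    (hFderiv : ∀ x ∈ Set.Ioi a, 0 < deriv F x)
    (hGderiv : ∀ x ∈ Set.Ioi b, 0 < deriv G x)
    (hFbij : Set.BijOn F (Set.Ioi a) (Set.Ioo 0 1))
    (hGbij : Set.BijOn G (Set.Ioi b) (Set.Ioo 0 1))
    (hFinvL : ∀ x ∈ Set.Ioi a, Finv (F x) = x)
    (hFinvR : ∀ u ∈ Set.Ioo (0:ℝ) 1, Finv u ∈ Set.Ioi a ∧ F (Finv u) = u)
    (hGinvL : ∀ x ∈ Set.Ioi b, Ginv (G x) = x)
    (hGinvR : ∀ u ∈ Set.Ioo (0:ℝ) 1, Ginv u ∈ Set.Ioi b ∧ G (Ginv u) = u) :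
    ConvexOn ℝ (Set.Ioi b) (fun x => Finv (G x)) ↔
      ∀ u ∈ Set.Ioo (0:ℝ) 1,
        -(deriv (deriv G) (Ginv u)) / (deriv G (Ginv u)) ^ 2 ≤
          -(deriv (deriv F) (Finv u)) / (deriv F (Finv u)) ^ 2 := by
  have key : ∀ (c : ℝ) (K : ℝ → ℝ), ContDiffOn ℝ 2 K (Set.Ioi c) → ∀ x ∈ Set.Ioi c,
      HasDerivAt K (deriv K x) x ∧ HasDerivAt (deriv K) (deriv (deriv K) x) x := by
    intro c K hK x hx
    have h1 : ContDiffOn ℝ 1 (deriv K) (Set.Ioi c) :=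
      hK.deriv_of_isOpen isOpen_Ioi (by norm_num)
    exact ⟨((hK.differentiableOn (by norm_num)).differentiableAt
        (isOpen_Ioi.mem_nhds hx)).hasDerivAt,
      ((h1.differentiableOn (by norm_num)).differentiableAt
        (isOpen_Ioi.mem_nhds hx)).hasDerivAt⟩
  have hFinvmono : StrictMonoOn Finv (Set.Ioo 0 1) := by
    intro u hu v hv huv
    by_contra! hle
    have := hFmono.monotoneOn (hFinvR v hv).1 (hFinvR u hu).1 hle
    rw [(hFinvR v hv).2, (hFinvR u hu).2] at this
    linarith
  have himg : Finv '' Set.Ioo 0 1 = Set.Ioi a := by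
    ext y
    constructor
    · rintro ⟨u, hu, rfl⟩
      exact (hFinvR u hu).1
    · intro hy
      exact ⟨F y, hFbij.mapsTo hy, hFinvL y hy⟩
  have hFinvD : ∀ u ∈ Set.Ioo (0:ℝ) 1, HasDerivAt Finv (deriv F (Finv u))⁻¹ u := by
    intro u hu
    have hc : ContinuousAt Finv u := by
      apply hFinvmono.continuousAt_of_image_mem_nhds (isOpen_Ioo.mem_nhds hu)
      rw [himg]
      exact isOpen_Ioi.mem_nhds (hFinvR u hu).1
    apply HasDerivAt.of_local_left_inverse hc (key a F hFsmooth _ (hFinvR u hu).1).1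
      (hFderiv _ (hFinvR u hu).1).ne'
    filter_upwards [isOpen_Ioo.mem_nhds hu] with v hv using (hFinvR v hv).2
  have hHD : ∀ x ∈ Set.Ioi b, HasDerivAt (fun x => Finv (G x))
      ((deriv F (Finv (G x)))⁻¹ * deriv G x) x := fun x hx =>
    (hFinvD _ (hGbij.mapsTo hx)).comp x (key b G hGsmooth x hx).1
  have hHD2 : ∀ x ∈ Set.Ioi b, HasDerivAt (deriv (fun x => Finv (G x)))
      ((deriv G x) ^ 2 / deriv F (Finv (G x)) *
        (-(deriv (deriv F) (Finv (G x))) / (deriv F (Finv (G x))) ^ 2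
          - -(deriv (deriv G) x) / (deriv G x) ^ 2)) x := by
    intro x hx
    have hm := (hFinvR _ (hGbij.mapsTo hx)).1
    have hFp := (hFderiv _ hm).ne'
    have hGp := (hGderiv _ hx).ne'
    have h1 : HasDerivAt (fun y => deriv F (Finv (G y)))
        (deriv (deriv F) (Finv (G x)) * ((deriv F (Finv (G x)))⁻¹ * deriv G x)) x :=
      HasDerivAt.comp (h₂ := deriv F) (h := fun x => Finv (G x)) x (key a F hFsmooth _ hm).2 (hHD x hx)
    have h2 := (h1.fun_inv hFp).mul (key b G hGsmooth x hx).2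
    refine (h2.congr_of_eventuallyEq ?_).congr_deriv ?_
    · filter_upwards [isOpen_Ioi.mem_nhds hx] with y hy using (hHD y hy).deriv
    · field_simp
      ring
  have hdiff : DifferentiableOn ℝ (fun x => Finv (G x)) (Set.Ioi b) :=
    fun x hx => (hHD x hx).differentiableAt.differentiableWithinAt
  constructor
  · intro hconv u hu
    obtain ⟨hx, hGx⟩ := hGinvR u hu
    have hmono : MonotoneOn (deriv (fun x => Finv (G x))) (Set.Ioi b) :=
      hconv.monotoneOn_deriv (fun x hx => (hHD x hx).differentiableAt)
    have hnn : 0 ≤ derivWithin (deriv (fun x => Finv (G x))) (Set.Ioi b) (Ginv u) :=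
      hmono.derivWithin_nonneg
    rw [derivWithin_of_isOpen isOpen_Ioi hx, (hHD2 _ hx).deriv, hGx] at hnn
    have hpos : 0 < (deriv G (Ginv u)) ^ 2 / deriv F (Finv u) :=
      div_pos (pow_pos (hGderiv _ hx) 2) (hFderiv _ (hFinvR u hu).1)
    exact sub_nonneg.mp (nonneg_of_mul_nonneg_right hnn hpos)
  · intro h
    apply convexOn_of_deriv2_nonneg' (convex_Ioi b) hdiff
      (fun x hx => (hHD2 x hx).differentiableAt.differentiableWithinAt)
    intro x hx
    have hu := hGbij.mapsTo hx
    have := h _ hu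
    rw [hGinvL x hx] at this
    simp only [Function.iterate_succ, Function.iterate_zero, Function.comp, id]
    rw [(hHD2 x hx).deriv]
    exact mul_nonneg (div_nonneg (sq_nonneg _) (hFderiv _ (hFinvR _ hu).1).le)
      (sub_nonneg.mpr this)
end

section
/- Let d ≥ 1, m ≥ 1, w_1,…,w_m ≥ 0 and δ ∈ ℝ. Let a, b_1,…,b_m ∈ ℝ, let F : (a,∞) → (0,1) and, for j = 1,…,m, G_j : (b_j,∞) → (0,1) be strictly increasing, twice continuously differentiable bijections with positive first derivatives, and suppose that for every j and every u ∈ (0,1), −F″(F^{−1}(u)) / (F′(F^{−1}(u)))² ≥ −G_j″(G_j^{−1}(u)) / (G_j′(G_j^{−1}(u)))². Let H_j : ℝ^d → ℝ be convex functions with H_j(x) > b_j for all x ∈ ℝ^d. Then the set {x ∈ ℝ^d : ∑_{j=1}^m w_j F^{−1}(G_j(H_j(x))) ≤ δ} is convex. -/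
theorem aux_deriv (a : ℝ) (F : ℝ → ℝ) (hF : ContDiffOn ℝ 2 F (Set.Ioi a)) (x : ℝ) (hx : a < x) :
    HasStrictDerivAt F (deriv F x) x ∧ HasDerivAt (deriv F) (deriv (deriv F) x) x := by
  have hc : ContDiffAt ℝ 2 F x := hF.contDiffAt (Ioi_mem_nhds hx)
  refine ⟨hc.hasStrictDerivAt (by norm_num), ?_⟩
  have h2 : ContDiffOn ℝ 1 (deriv F) (Set.Ioi a) :=
    ((contDiffOn_succ_iff_deriv_of_isOpen (n := 1) isOpen_Ioi).1
      (by simpa [one_add_one_eq_two] using hF)).2.2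
  exact ((h2.contDiffAt (Ioi_mem_nhds hx)).differentiableAt (by norm_num)).hasDerivAt

theorem aux_convex (a b : ℝ) (F Finv G Ginv : ℝ → ℝ)
    (hFsmooth : ContDiffOn ℝ 2 F (Set.Ioi a))
    (hFderiv : ∀ x ∈ Set.Ioi a, 0 < deriv F x)
    (hFinvL : ∀ x ∈ Set.Ioi a, Finv (F x) = x)
    (hFinvR : ∀ u ∈ Set.Ioo (0:ℝ) 1, Finv u ∈ Set.Ioi a ∧ F (Finv u) = u)
    (hGsmooth : ContDiffOn ℝ 2 G (Set.Ioi b))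
    (hGderiv : ∀ x ∈ Set.Ioi b, 0 < deriv G x)
    (hGbij : Set.BijOn G (Set.Ioi b) (Set.Ioo 0 1))
    (hGinvL : ∀ x ∈ Set.Ioi b, Ginv (G x) = x)
    (hT : ∀ u ∈ Set.Ioo (0:ℝ) 1,
      -(deriv (deriv G) (Ginv u)) / (deriv G (Ginv u)) ^ 2 ≤
        -(deriv (deriv F) (Finv u)) / (deriv F (Finv u)) ^ 2) :
    ConvexOn ℝ (Set.Ioi b) (fun x => Finv (G x)) ∧
      MonotoneOn (fun x => Finv (G x)) (Set.Ioi b) := by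
  have h1 : ∀ x ∈ Set.Ioi b, HasDerivAt (fun x => Finv (G x))
      (deriv G x / deriv F (Finv (G x))) x := by
    intro x hx
    obtain ⟨hy, hFy⟩ := hFinvR _ (hGbij.mapsTo hx)
    have hs := (aux_deriv a F hFsmooth _ hy).1.to_local_left_inverse (hFderiv _ hy).ne'
      (g := Finv) (by filter_upwards [Ioi_mem_nhds hy] with z hz using hFinvL z hz)
    rw [hFy] at hs
    have := hs.hasDerivAt.comp x (aux_deriv b G hGsmooth x hx).1.hasDerivAt
    rw [div_eq_inv_mul]
    exact this
  have h2 : ∀ x ∈ Set.Ioi b, HasDerivAt (fun x => deriv G x / deriv F (Finv (G x)))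
      ((deriv (deriv G) x * deriv F (Finv (G x)) - deriv G x *
        (deriv (deriv F) (Finv (G x)) * (deriv G x / deriv F (Finv (G x))))) /
          deriv F (Finv (G x)) ^ 2) x := by
    intro x hx
    obtain ⟨hy, hFy⟩ := hFinvR _ (hGbij.mapsTo hx)
    have h3 : HasDerivAt (fun x => deriv F (Finv (G x)))
        (deriv (deriv F) (Finv (G x)) * (deriv G x / deriv F (Finv (G x)))) x := by
      have h4 := (aux_deriv a F hFsmooth _ hy).2
      have h5 := HasDerivAt.comp (h := fun x => Finv (G x)) x h4 (h1 x hx)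
      exact h5
    exact (aux_deriv b G hGsmooth x hx).2.div h3 (hFderiv _ hy).ne'
  have hcont : ContinuousOn (fun x => Finv (G x)) (Set.Ioi b) :=
    fun x hx => (h1 x hx).continuousAt.continuousWithinAt
  constructor
  · refine convexOn_of_hasDerivWithinAt2_nonneg (convex_Ioi b) hcont
      (fun x hx => (h1 x (interior_subset hx)).hasDerivWithinAt)
      (fun x hx => (h2 x (interior_subset hx)).hasDerivWithinAt) ?_
    intro x hx
    have hx := interior_subset hx
    obtain ⟨hy, hFy⟩ := hFinvR _ (hGbij.mapsTo hx)
    have ht := hT _ (hGbij.mapsTo hx)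
    rw [hGinvL x hx] at ht
    have hf := hFderiv _ hy
    have hg := hGderiv _ hx
    generalize deriv F (Finv (G x)) = f at *
    generalize deriv (deriv F) (Finv (G x)) = f2 at *
    generalize deriv (deriv G) x = g2 at *
    generalize deriv G x = g at *
    have e : (g2 * f - g * (f2 * (g / f))) / f ^ 2
        = g ^ 2 / f * (-f2 / f ^ 2 - -g2 / g ^ 2) := by
      field_simp
      ring
    rw [e]
    exact mul_nonneg (by positivity) (sub_nonneg.2 ht)
  · refine monotoneOn_of_hasDerivWithinAt_nonneg (convex_Ioi b) hcont
      (fun x hx => (h1 x (interior_subset hx)).hasDerivWithinAt) ?_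
    intro x hx
    have hx := interior_subset hx
    obtain ⟨hy, hFy⟩ := hFinvR _ (hGbij.mapsTo hx)
    exact (div_pos (hGderiv _ hx) (hFderiv _ hy)).le

/-- Lemma C.3 (second part): if the 𝒯-transform of `F` dominates those of the `G j` and each
`H j` is convex with values above `b j`, then the sublevel set
`{x | ∑ⱼ wⱼ F⁻¹(Gⱼ(Hⱼ(x))) ≤ δ}` is convex. -/
theorem convex_sublevel_of_tTransform_domination
    (d m : ℕ) (hd : 1 ≤ d) (hm : 1 ≤ m)
    (w : Fin m → ℝ) (hw : ∀ j, 0 ≤ w j) (δ : ℝ)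
    (a : ℝ) (b : Fin m → ℝ)
    (F Finv : ℝ → ℝ) (G Ginv : Fin m → ℝ → ℝ)
    (hFmono : StrictMonoOn F (Set.Ioi a))
    (hFsmooth : ContDiffOn ℝ 2 F (Set.Ioi a))
    (hFderiv : ∀ x ∈ Set.Ioi a, 0 < deriv F x)
    (hFbij : Set.BijOn F (Set.Ioi a) (Set.Ioo 0 1))
    (hFinvL : ∀ x ∈ Set.Ioi a, Finv (F x) = x)
    (hFinvR : ∀ u ∈ Set.Ioo (0:ℝ) 1, Finv u ∈ Set.Ioi a ∧ F (Finv u) = u)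
    (hGmono : ∀ j, StrictMonoOn (G j) (Set.Ioi (b j)))
    (hGsmooth : ∀ j, ContDiffOn ℝ 2 (G j) (Set.Ioi (b j)))
    (hGderiv : ∀ j, ∀ x ∈ Set.Ioi (b j), 0 < deriv (G j) x)
    (hGbij : ∀ j, Set.BijOn (G j) (Set.Ioi (b j)) (Set.Ioo 0 1))
    (hGinvL : ∀ j, ∀ x ∈ Set.Ioi (b j), Ginv j (G j x) = x)
    (hGinvR : ∀ j, ∀ u ∈ Set.Ioo (0:ℝ) 1, Ginv j u ∈ Set.Ioi (b j) ∧ G j (Ginv j u) = u)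
    (hT : ∀ j, ∀ u ∈ Set.Ioo (0:ℝ) 1,
      -(deriv (deriv (G j)) (Ginv j u)) / (deriv (G j) (Ginv j u)) ^ 2 ≤
        -(deriv (deriv F) (Finv u)) / (deriv F (Finv u)) ^ 2)
    (H : Fin m → (Fin d → ℝ) → ℝ)
    (hH : ∀ j, ConvexOn ℝ Set.univ (H j))
    (hHb : ∀ j x, b j < H j x) :
    Convex ℝ {x : Fin d → ℝ | ∑ j, w j * Finv (G j (H j x)) ≤ δ} := by
  have key : ConvexOn ℝ Set.univ (fun x : Fin d → ℝ => ∑ j, w j * Finv (G j (H j x))) := by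
    refine ⟨convex_univ, ?_⟩
    intro x _ y _ s t hs ht hst
    simp only [smul_eq_mul, Finset.mul_sum]
    rw [← Finset.sum_add_distrib]
    refine Finset.sum_le_sum fun j _ => ?_
    obtain ⟨hc, hmn⟩ := aux_convex a (b j) F Finv (G j) (Ginv j) hFsmooth hFderiv hFinvL hFinvR
      (hGsmooth j) (hGderiv j) (hGbij j) (hGinvL j) (hT j)
    have e1 := (hH j).2 (Set.mem_univ x) (Set.mem_univ y) hs ht hst
    have e2 := hc.2 (hHb j x) (hHb j y) hs ht hst
    have e3 := hmn (hHb j _) (lt_of_lt_of_le (hHb j _) e1) e1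
    have e4 := mul_le_mul_of_nonneg_left (e3.trans e2) (hw j)
    simp only [smul_eq_mul] at e4
    linarith
  simpa using key.convex_le δ
end

section
/- The function k ↦ (k+1)·B(k/2, 1/2)² is nonincreasing on [1,∞), where B(a,b) = Γ(a)Γ(b)/Γ(a+b) is the Beta function; in particular, for every real k ≥ 1, (k+1)·B(k/2, 1/2)² ≥ (k+2)·B((k+1)/2, 1/2)². -/
open Real

/-- The Beta function `B(a,b) = Γ(a)Γ(b)/Γ(a+b)`. -/
noncomputable def betaFn (a b : ℝ) : ℝ := Real.Gamma a * Real.Gamma b / Real.Gamma (a + b)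

/-- The normalized function, in the variable `x = k / 2`. -/
noncomputable def gAux (x : ℝ) : ℝ := (x + 1 / 2) * (Real.Gamma x / Real.Gamma (x + 1 / 2)) ^ 2

/-- The ratio `gAux x / gAux (x + 1)`. -/
noncomputable def phiAux (x : ℝ) : ℝ := (x + 1 / 2) ^ 3 / (x ^ 2 * (x + 3 / 2))

lemma gAux_pos {x : ℝ} (hx : 0 < x) : 0 < gAux x := by
  have h1 := Real.Gamma_pos_of_pos hx
  have h2 : 0 < Real.Gamma (x + 1 / 2) := Real.Gamma_pos_of_pos (by linarith)
  unfold gAux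
  positivity

lemma phiAux_pos {x : ℝ} (hx : 0 < x) : 0 < phiAux x := by
  unfold phiAux
  positivity

lemma gAux_eq {x : ℝ} (hx : 0 < x) : gAux x = phiAux x * gAux (x + 1) := by
  have h1 := Real.Gamma_pos_of_pos hx
  have h2 : 0 < Real.Gamma (x + 1 / 2) := Real.Gamma_pos_of_pos (by linarith)
  have e1 := Real.Gamma_add_one hx.ne'
  have e2 : Real.Gamma (x + 1 + 1 / 2) = (x + 1 / 2) * Real.Gamma (x + 1 / 2) := by
    rw [← Real.Gamma_add_one (by linarith)]
    congr 1
    ring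
  unfold gAux phiAux
  rw [e1, e2]
  have h3 : x + 1 + 1 / 2 = x + 3 / 2 := by ring
  rw [h3]
  have h4 : x + 3 / 2 ≠ 0 := by positivity
  have h5 : x + 1 / 2 ≠ 0 := by positivity
  generalize x + 3 / 2 = a at *
  generalize Real.Gamma (x + 1 / 2) = c at *
  generalize x + 1 / 2 = b at *
  field_simp

lemma phiAux_anti {x y : ℝ} (hx : 0 < x) (hxy : x ≤ y) : phiAux y ≤ phiAux x := by
  have hy : 0 < y := by linarith
  unfold phiAux
  rw [div_le_div_iff₀ (by positivity) (by positivity)]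
  obtain ⟨d, rfl⟩ : ∃ d, y = x + d := ⟨y - x, by ring⟩
  have hd : 0 ≤ d := by linarith
  rw [← sub_nonneg]
  ring_nf
  positivity

lemma gAux_cross {x y : ℝ} (hx : 0 < x) (hxy : x ≤ y) (n : ℕ) :
    gAux y * gAux (x + n) ≤ gAux x * gAux (y + n) := by
  have hy : 0 < y := by linarith
  induction n with
  | zero => simp [mul_comm]
  | succ n ih =>
    have hxn : 0 < x + n := by positivity
    have hyn : 0 < y + n := by positivity
    rw [gAux_eq hxn, gAux_eq hyn] at ih
    push_cast
    rw [← add_assoc, ← add_assoc]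
    have hp := phiAux_anti hxn (y := y + n) (by linarith)
    have hq := phiAux_pos hxn
    have hG : 0 < gAux x * gAux (y + n + 1) := mul_pos (gAux_pos hx) (gAux_pos (by linarith))
    have := mul_le_mul_of_nonneg_right hp hG.le
    refine le_of_mul_le_mul_left ?_ hq
    linarith

lemma Gamma_mid {x : ℝ} (hx : 0 < x) :
    Real.Gamma (x + 1 / 2) ^ 2 ≤ Real.Gamma x * Real.Gamma (x + 1) := by
  have h := Real.Gamma_mul_add_mul_le_rpow_Gamma_mul_rpow_Gamma hx
    (show 0 < x + 1 by linarith) (show (0 : ℝ) < 1 / 2 by norm_num)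
    (show (0 : ℝ) < 1 / 2 by norm_num) (by norm_num)
  rw [show 1 / 2 * x + 1 / 2 * (x + 1) = x + 1 / 2 by ring, ← Real.sqrt_eq_rpow,
    ← Real.sqrt_eq_rpow] at h
  have h0 : 0 < Real.Gamma (x + 1 / 2) := Real.Gamma_pos_of_pos (by linarith)
  have h1 := Real.Gamma_pos_of_pos hx
  have h2 : 0 < Real.Gamma (x + 1) := Real.Gamma_pos_of_pos (by linarith)
  calc _ ≤ (√(Real.Gamma x) * √(Real.Gamma (x + 1))) ^ 2 := by gcongr
    _ = _ := by rw [mul_pow, Real.sq_sqrt h1.le, Real.sq_sqrt h2.le]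

lemma one_le_gAux {x : ℝ} (hx : 0 < x) : 1 ≤ gAux x := by
  have h := Gamma_mid hx
  have h1 := Real.Gamma_pos_of_pos hx
  have h2 : 0 < Real.Gamma (x + 1 / 2) := Real.Gamma_pos_of_pos (by linarith)
  rw [Real.Gamma_add_one hx.ne'] at h
  unfold gAux
  rw [div_pow, mul_div_assoc', le_div_iff₀ (by positivity)]
  nlinarith [sq_nonneg (Real.Gamma x)]

lemma gAux_le {x : ℝ} (hx : 0 < x) : gAux (x + 1 / 2) ≤ 1 + 1 / x := by
  have h := Gamma_mid hx
  have h1 := Real.Gamma_pos_of_pos hx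
  have e := Real.Gamma_add_one hx.ne'
  have e2 : x + 1 / 2 + 1 / 2 = x + 1 := by ring
  unfold gAux
  rw [e2, div_pow, e, mul_div_assoc', div_le_iff₀ (by positivity)]
  rw [e] at h
  calc (x + 1) * Real.Gamma (x + 1 / 2) ^ 2 ≤ (x + 1) * (Real.Gamma x * (x * Real.Gamma x)) := by
        gcongr
    _ = _ := by field_simp

lemma gAux_anti {x y : ℝ} (hx : 0 < x) (hxy : x ≤ y) : gAux y ≤ gAux x := by
  have hy : 0 < y := by linarith
  have hb : ∀ n : ℕ, gAux y ≤ gAux x * (1 + 1 / ((n : ℝ) + 1)) := by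
    intro n
    have h := gAux_cross hx hxy (n + 2)
    push_cast at h
    have h1 : 1 ≤ gAux (x + (n + 2)) := one_le_gAux (by positivity)
    have h2 := gAux_le (x := y + n + 3 / 2) (by positivity)
    rw [show y + n + 3 / 2 + 1 / 2 = y + (n + 2) by ring] at h2
    have h3 : 1 / (y + n + 3 / 2) ≤ 1 / ((n : ℝ) + 1) := by
      apply one_div_le_one_div_of_le (by positivity); linarith
    have hgx := gAux_pos hx
    have hgy := gAux_pos hy
    calc gAux y ≤ gAux y * gAux (x + (n + 2)) := le_mul_of_one_le_right hgy.le h1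
      _ ≤ gAux x * gAux (y + (n + 2)) := h
      _ ≤ _ := by gcongr; linarith
  have ht : Filter.Tendsto (fun n : ℕ => gAux x * (1 + 1 / ((n : ℝ) + 1))) Filter.atTop
      (nhds (gAux x * (1 + 0))) :=
    (tendsto_one_div_add_atTop_nhds_zero_nat.const_add 1).const_mul _
  simpa using ge_of_tendsto' ht hb

lemma beta_eq (k : ℝ) :
    (k + 1) * (betaFn (k / 2) (1 / 2)) ^ 2 = 2 * Real.Gamma (1 / 2) ^ 2 * gAux (k / 2) := by
  unfold betaFn gAux
  ring

lemma beta_anti {k l : ℝ} (hk : 1 ≤ k) (hkl : k ≤ l) :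
    (l + 1) * (betaFn (l / 2) (1 / 2)) ^ 2 ≤ (k + 1) * (betaFn (k / 2) (1 / 2)) ^ 2 := by
  rw [beta_eq, beta_eq]
  have := gAux_anti (x := k / 2) (y := l / 2) (by linarith) (by linarith)
  gcongr

/-- The function `k ↦ (k+1)·B(k/2,1/2)²` is nonincreasing on `[1,∞)`; in particular
`(k+2)·B((k+1)/2,1/2)² ≤ (k+1)·B(k/2,1/2)²` for every `k ≥ 1`. -/
theorem beta_ratio_antitone :
    AntitoneOn (fun k : ℝ => (k + 1) * (betaFn (k / 2) (1 / 2)) ^ 2) (Set.Ici 1) ∧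
      ∀ k : ℝ, 1 ≤ k →
        (k + 2) * (betaFn ((k + 1) / 2) (1 / 2)) ^ 2 ≤
          (k + 1) * (betaFn (k / 2) (1 / 2)) ^ 2 := by
  refine ⟨fun k hk l _ hkl => beta_anti hk hkl, fun k hk => ?_⟩
  have h := beta_anti hk (show k ≤ k + 1 by linarith)
  rwa [show k + 1 + 1 = k + 2 by ring] at h
end

section
/- Let m ≥ 1, let w_1,…,w_m ≥ 0 with ∑_{j=1}^m w_j = 1, let θ̂_1,…,θ̂_m ∈ ℝ and σ̂_1,…,σ̂_m > 0, and for each j let F_j : ℝ → ℝ be a function satisfying 1/2 + (1/π)·arctan x ≤ F_j(x) < 1 for every x ≥ 0. Then for every θ ∈ ℝ, ∑_{j=1}^m w_j · cot( π (1 − F_j(|θ̂_j − θ|/σ̂_j)) ) ≥ ∑_{j=1}^m w_j · |θ̂_j − θ| / σ̂_j. -/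
open Real

/-- Equation (14): the HCCT score dominates the weighted L1 inconsistency measure
`∑ wⱼ |θ̂ⱼ − θ|/σ̂ⱼ`, for any CDFs `Fⱼ` dominating the Cauchy CDF on `[0,∞)`. -/
theorem hcct_score_lower_bound
    (m : ℕ) (hm : 1 ≤ m)
    (w : Fin m → ℝ) (hw : ∀ j, 0 ≤ w j) (hwsum : ∑ j, w j = 1)
    (θhat σhat : Fin m → ℝ) (hσ : ∀ j, 0 < σhat j)
    (F : Fin m → ℝ → ℝ)
    (hFlb : ∀ j, ∀ x : ℝ, 0 ≤ x → 1 / 2 + (1 / π) * Real.arctan x ≤ F j x)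
    (hFub : ∀ j, ∀ x : ℝ, 0 ≤ x → F j x < 1)
    (θ : ℝ) :
    ∑ j, w j * (|θhat j - θ| / σhat j) ≤
      ∑ j, w j * Real.cot (π * (1 - F j (|θhat j - θ| / σhat j))) := by
  refine Finset.sum_le_sum fun j _ => mul_le_mul_of_nonneg_left ?_ (hw j)
  have hx : 0 ≤ |θhat j - θ| / σhat j := div_nonneg (abs_nonneg _) (hσ j).le
  generalize |θhat j - θ| / σhat j = x at hx
  have h1 := hFlb j x hx
  have h2 := hFub j x hx
  have hpi := Real.pi_pos
  rw [← Real.tan_inv_eq_cot, ← Real.tan_pi_div_two_sub]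
  have h3 : Real.arctan x ≤ π / 2 - π * (1 - F j x) := by
    have h := mul_le_mul_of_nonneg_left h1 hpi.le
    have e : π * (1 / 2 + (1 / π) * Real.arctan x) = π / 2 + Real.arctan x := by
      field_simp
    rw [e] at h
    linarith
  have h4 : π / 2 - π * (1 - F j x) < π / 2 := by
    have := mul_pos hpi (sub_pos.mpr h2)
    linarith
  rcases h3.eq_or_lt with h | h
  · rw [← h, Real.tan_arctan]
  · have := Real.tan_lt_tan_of_lt_of_lt_pi_div_two (Real.neg_pi_div_two_lt_arctan x) h4 h
    rw [Real.tan_arctan] at this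
    exact this.le
end
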